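/- Let E₁, E, and F be normed spaces, let S : E₁ → E be a continuous linear map lying in the operator-norm closure of the set of finite rank continuous linear maps from E₁ to E, let ι be an index type with a filter l on it, let (T_i)_{i∈ι} be a norm bounded family of continuous linear maps from E to F, and let T : E → F be a continuous linear map such that T_i e → T e along l for every e ∈ E. Then ‖T_i ∘ S − T ∘ S‖ → 0 along l in the operator norm. -/

import Mathlib

open Filter Topology

/-- An operator inequality `‖f x‖ ≤ ε * ‖x‖` on `W` and a bound on `‖f v‖` give a bound on
`W + 𝕜 v`, as soon as `v` has distance at least `d` from `W`. -/
theorem norm_apply_add_smul_le_of_le_dist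
    {𝕜 E F : Type*} [NontriviallyNormedField 𝕜] [NormedAddCommGroup E] [NormedSpace 𝕜 E]
    [NormedAddCommGroup F] [NormedSpace 𝕜 F] {W : Submodule 𝕜 E} {v : E} {d : ℝ} (hd : 0 < d)
    (hdist : ∀ w ∈ W, d ≤ dist v w) (f : E →L[𝕜] F) {ε η : ℝ} (hε : 0 ≤ ε)
    (hf : ∀ w ∈ W, ‖f w‖ ≤ ε * ‖w‖) (hv : ‖f v‖ ≤ η) {w : E} (hw : w ∈ W) (c : 𝕜) :
    ‖f (w + c • v)‖ ≤ (ε * (1 + ‖v‖ / d) + η / d) * ‖w + c • v‖ := by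
  have hη : 0 ≤ η := (norm_nonneg _).trans hv
  have hc : ‖c‖ ≤ ‖w + c • v‖ / d := by
    rw [le_div_iff₀ hd]
    rcases eq_or_ne c 0 with rfl | hc0
    · simp
    · have h := hdist _ (W.neg_mem (W.smul_mem c⁻¹ hw))
      have hx : w + c • v = c • (v - -(c⁻¹ • w)) := by
        rw [sub_neg_eq_add, smul_add, smul_inv_smul₀ hc0, add_comm]
      rw [dist_eq_norm] at h
      rw [hx, norm_smul]
      gcongr
  have hw_norm : ‖w‖ ≤ ‖w + c • v‖ + ‖c‖ * ‖v‖ := by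
    simpa [norm_smul] using norm_sub_le (w + c • v) (c • v)
  calc ‖f (w + c • v)‖ ≤ ‖f w‖ + ‖c‖ * ‖f v‖ := by
        rw [map_add, map_smul, ← norm_smul]; exact norm_add_le _ _
    _ ≤ ε * (‖w + c • v‖ + ‖w + c • v‖ / d * ‖v‖) + ‖w + c • v‖ / d * η := by
        have h₁ : ‖w‖ ≤ ‖w + c • v‖ + ‖w + c • v‖ / d * ‖v‖ := hw_norm.trans (by gcongr)
        have h₂ := hf w hw
        gcongr
        exact h₂.trans (by gcongr)
    _ = _ := by ring

/-- On a finite-dimensional subspace, pointwise convergence to zero of continuous linear maps is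
uniform on bounded sets. The scalar field need not be complete. -/
theorem eventually_norm_apply_le_of_fg
    {𝕜 E F ι : Type*} [NontriviallyNormedField 𝕜] [NormedAddCommGroup E] [NormedSpace 𝕜 E]
    [NormedAddCommGroup F] [NormedSpace 𝕜 F] {l : Filter ι} {R : ι → E →L[𝕜] F}
    (hR : ∀ e, Tendsto (fun i => R i e) l (𝓝 0)) {W : Submodule 𝕜 E} (hW : W.FG)
    {ε : ℝ} (hε : 0 < ε) : ∀ᶠ i in l, ∀ x ∈ W, ‖R i x‖ ≤ ε * ‖x‖ := by
  classical
  obtain ⟨s, rfl⟩ := hW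
  induction s using Finset.induction_on generalizing ε with
  | empty => simp
  | insert v s _ ih =>
    set W := Submodule.span 𝕜 (s : Set E)
    by_cases hv : v ∈ closure (W : Set E)
    · filter_upwards [ih hε] with i hi x hx
      have hle : Submodule.span 𝕜 ((insert v s : Finset E) : Set E) ≤ W.topologicalClosure := by
        rw [Submodule.span_le, Finset.coe_insert, Set.insert_subset_iff]
        exact ⟨hv, Submodule.subset_span.trans W.le_topologicalClosure⟩
      have hclosed : IsClosed {x : E | ‖R i x‖ ≤ ε * ‖x‖} :=
        isClosed_le (by fun_prop) (by fun_prop)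
      exact closure_minimal hi hclosed (hle hx)
    · obtain ⟨d, hd, hdist⟩ : ∃ d > 0, ∀ w ∈ W, d ≤ dist v w := by
        simpa [Metric.mem_closure_iff] using hv
      have hpos : 0 < 1 + ‖v‖ / d := by positivity
      have hRv : ∀ᶠ i in l, ‖R i v‖ < ε / 2 * d := by
        have h := (hR v).norm
        rw [norm_zero] at h
        exact h.eventually_lt_const (by positivity)
      filter_upwards [ih (show 0 < ε / 2 / (1 + ‖v‖ / d) by positivity), hRv] with i hi hiv x hx
      rw [Finset.coe_insert, Submodule.mem_span_insert] at hx
      obtain ⟨c, w, hw, rfl⟩ := hx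
      rw [add_comm]
      refine (norm_apply_add_smul_le_of_le_dist hd hdist (R i) (by positivity) hi hiv.le hw
        c).trans_eq ?_
      rw [div_mul_cancel₀ _ hpos.ne', mul_div_cancel_right₀ _ hd.ne', add_halves]

/-- If `S : E₁ → E` is a continuous linear map lying in the operator-norm closure of the finite
rank continuous linear maps, and `(T_i)` is a norm bounded family of continuous linear maps
`E → F` converging pointwise to `T`, then `‖T_i ∘ S - T ∘ S‖ → 0` in the operator norm. -/
theorem tendsto_comp_of_approx_finite_rank
    {𝕜 : Type*} [NontriviallyNormedField 𝕜]
    {E₁ E F : Type*} [NormedAddCommGroup E₁] [NormedSpace 𝕜 E₁]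
    [NormedAddCommGroup E] [NormedSpace 𝕜 E] [NormedAddCommGroup F] [NormedSpace 𝕜 F]
    (S : E₁ →L[𝕜] E)
    (hS : S ∈ closure {A : E₁ →L[𝕜] E | FiniteDimensional 𝕜 (LinearMap.range (A : E₁ →ₗ[𝕜] E))})
    {ι : Type*} (l : Filter ι) (T : ι → E →L[𝕜] F) (T₀ : E →L[𝕜] F)
    (hbdd : ∃ C : ℝ, ∀ i, ‖T i‖ ≤ C)
    (hptwise : ∀ e : E, Tendsto (fun i => T i e) l (𝓝 (T₀ e))) :
    Tendsto (fun i => ‖(T i).comp S - T₀.comp S‖) l (𝓝 0) := by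
  obtain ⟨C, hC⟩ := hbdd
  set M : ℝ := |C| + ‖T₀‖ + 1
  have hMpos : 0 < M := by positivity
  have hR (i : ι) : ‖T i - T₀‖ ≤ M := by
    linarith [norm_sub_le (T i) T₀, hC i, le_abs_self C]
  have hlim (e : E) : Tendsto (fun i => (T i - T₀) e) l (𝓝 0) := by
    simpa using (hptwise e).sub_const (T₀ e)
  refine squeeze_zero_norm' (a := fun i => ‖(T i - T₀).comp S‖) (by simp) ?_
  refine Metric.tendsto_nhds.2 fun ε hε => ?_
  obtain ⟨A, hA, hSA⟩ := Metric.mem_closure_iff.1 hS (ε / 3 / M) (by positivity)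
  rw [dist_eq_norm] at hSA
  have hfg : (LinearMap.range (A : E₁ →ₗ[𝕜] E)).FG := Module.Finite.iff_fg.1 hA
  filter_upwards [eventually_norm_apply_le_of_fg hlim hfg
    (show 0 < ε / 3 / (‖A‖ + 1) by positivity)] with i hi
  have hcompA : ‖(T i - T₀).comp A‖ ≤ ε / 3 := by
    refine ContinuousLinearMap.opNorm_le_bound _ (by positivity) fun x => ?_
    calc ‖(T i - T₀) (A x)‖ ≤ ε / 3 / (‖A‖ + 1) * ‖A x‖ := hi _ ⟨x, rfl⟩
      _ ≤ ε / 3 / (‖A‖ + 1) * ((‖A‖ + 1) * ‖x‖) := by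
        gcongr
        exact (A.le_opNorm x).trans (by gcongr; linarith)
      _ = ε / 3 * ‖x‖ := by field_simp
  have hcompSA : ‖(T i - T₀).comp (S - A)‖ ≤ ε / 3 := by
    calc ‖(T i - T₀).comp (S - A)‖ ≤ ‖T i - T₀‖ * ‖S - A‖ :=
        ContinuousLinearMap.opNorm_comp_le _ _
      _ ≤ M * (ε / 3 / M) := by gcongr; exact hR i
      _ = ε / 3 := by field_simp
  have hsplit : (T i - T₀).comp S = (T i - T₀).comp (S - A) + (T i - T₀).comp A := by
    ext x; simp
  rw [dist_zero_right, norm_norm, hsplit]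
  linarith [norm_add_le ((T i - T₀).comp (S - A)) ((T i - T₀).comp A)]
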